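/- Let U be an ultrafilter on a countably infinite set X and let I ⊆ U* be an ideal on X. If U has the I-pseudo-intersection property and ∏_{n<ω} I ≤_T U (I ordered by ⊆), then U·U ≡_T U. -/

import Mathlib

open Set

/-- A subset `S` is bounded with respect to the relation `r`. -/
def RelBounded {α : Type*} (r : α → α → Prop) (S : Set α) : Prop :=
  ∃ b, ∀ a ∈ S, r a b

/-- Tukey reducibility between two ordered sets: there is a map sending every
unbounded set to an unbounded set. -/
def TukeyLE {α β : Type*} (ra : α → α → Prop) (rb : β → β → Prop) : Prop :=
  ∃ f : α → β, ∀ S : Set α, ¬ RelBounded ra S → ¬ RelBounded rb (f '' S)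

/-- Tukey equivalence. -/
def TukeyEquiv {α β : Type*} (ra : α → α → Prop) (rb : β → β → Prop) : Prop :=
  TukeyLE ra rb ∧ TukeyLE rb ra

/-- `S` is cofinal with respect to the relation `r`. -/
def IsCofinalIn {α : Type*} (r : α → α → Prop) (S : Set α) : Prop :=
  ∀ a, ∃ b ∈ S, r a b

/-- The poset `(U, ⊇)` associated to a filter `U`: `A ≤ B` iff `A ⊇ B`. -/
def filtRel {X : Type*} (U : Filter X) :
    {A : Set X // A ∈ U} → {A : Set X // A ∈ U} → Prop :=
  fun A B => B.1 ⊆ A.1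

/-- The poset `(I, ⊆)` associated to a family of sets `I`. -/
def subRel {X : Type*} (I : Set (Set X)) :
    {A : Set X // A ∈ I} → {A : Set X // A ∈ I} → Prop :=
  fun A B => A.1 ⊆ B.1

/-- The Fubini product of filters: `A ∈ U·V` iff `{x | (A)_x ∈ V} ∈ U`,
where `(A)_x = {y | (x, y) ∈ A}`. -/
def fubini {X Y : Type*} (U : Filter X) (V : Filter Y) : Filter (X × Y) :=
  U.bind fun x => V.map (Prod.mk x)

/-- The ω-fold power of an ordered set, with the everywhere (pointwise)
domination order. -/
def seqRel {α : Type*} (r : α → α → Prop) : (ℕ → α) → (ℕ → α) → Prop :=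
  fun f g => ∀ n, r (f n) (g n)

/-- The product order on a Cartesian product of two ordered sets. -/
def prodRel {α β : Type*} (ra : α → α → Prop) (rb : β → β → Prop) :
    α × β → α × β → Prop :=
  fun p q => ra p.1 q.1 ∧ rb p.2 q.2

/-- The everywhere domination order on `ω^ω`. -/
def domRel : (ℕ → ℕ) → (ℕ → ℕ) → Prop := fun f g => ∀ n, f n ≤ g n

/-- An ideal on `X`: a family of subsets containing `∅`, closed under subsets
and finite unions. -/
def IsIdeal {X : Type*} (I : Set (Set X)) : Prop :=
  ∅ ∈ I ∧ (∀ A ∈ I, ∀ B ⊆ A, B ∈ I) ∧ (∀ A ∈ I, ∀ B ∈ I, A ∪ B ∈ I)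

/-- `U` has the `I`-pseudo-intersection property: every ω-sequence of members of `U`
has a pseudo-intersection modulo `I` in `U`. -/
def HasPIP {X : Type*} (U : Filter X) (I : Set (Set X)) : Prop :=
  ∀ A : ℕ → Set X, (∀ n, A n ∈ U) → ∃ B ∈ U, ∀ n, B \ A n ∈ I

/-- A p-point: a nonprincipal ultrafilter on `ω` which has the fin-pseudo-intersection
property. -/
def IsPPoint (U : Ultrafilter ℕ) : Prop :=
  (∀ a : ℕ, (U : Filter ℕ) ≠ pure a) ∧
  ∀ A : ℕ → Set ℕ, (∀ n, A n ∈ U) → ∃ B ∈ U, ∀ n, (B \ A n).Finite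

/-- A rapid ultrafilter: a nonprincipal ultrafilter `U` on `ω` such that for every
increasing `f : ω → ω` there is `X ∈ U` with `|X ∩ f(n)| ≤ n` for all `n`. -/
def IsRapid (U : Ultrafilter ℕ) : Prop :=
  (∀ a : ℕ, (U : Filter ℕ) ≠ pure a) ∧
  ∀ f : ℕ → ℕ, StrictMono f → ∃ X ∈ U, ∀ n, (X ∩ Set.Iio (f n)).ncard ≤ n

/-- The ideal `fin ⊗ fin` on `ω × ω`: all sets with only finitely many infinite
vertical sections. -/
def finOtimesFin : Set (Set (ℕ × ℕ)) :=
  {A | {n : ℕ | {m : ℕ | (n, m) ∈ A}.Infinite}.Finite}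

theorem mem_fubini {X Y : Type*} {U : Filter X} {V : Filter Y} {A : Set (X × Y)} :
    A ∈ fubini U V ↔ {x | {y | (x, y) ∈ A} ∈ V} ∈ U :=
  Iff.rfl

/-- A nontrivial filter is Tukey below its Fubini products with nontrivial filters. -/
theorem tukeyLE_fubini_left {X Y : Type*} (U : Filter X) (V : Filter Y) [V.NeBot] :
    TukeyLE (filtRel U) (filtRel (fubini U V)) := by
  have hcyl : ∀ A : {A : Set X // A ∈ U}, {p : X × Y | p.1 ∈ A.1} ∈ fubini U V := fun A => by
    rw [mem_fubini]
    filter_upwards [A.2] with x hx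
    exact Filter.mem_of_superset Filter.univ_mem fun y _ => hx
  refine ⟨fun A => ⟨_, hcyl A⟩, fun S hS => mt ?_ hS⟩
  rintro ⟨⟨B, hB⟩, hb⟩
  refine ⟨⟨{x | {y | (x, y) ∈ B} ∈ V}, mem_fubini.1 hB⟩, fun A hA x hx => ?_⟩
  obtain ⟨y, hy⟩ := Filter.nonempty_of_mem hx
  exact hb _ (mem_image_of_mem _ hA) hy

/-- If `U` has the `I`-pseudo-intersection property and `∏_{n<ω} I ≤_T U`, then `U·U ≤_T U`. -/
theorem fubini_self_tukeyLE {X : Type*} [Countable X] [Nonempty X] (U : Filter X)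
    (I : Set (Set X)) (hIU : ∀ A ∈ I, Aᶜ ∈ U) (hpip : HasPIP U I)
    (hT : TukeyLE (seqRel (subRel I)) (filtRel U)) :
    TukeyLE (filtRel (fubini U U)) (filtRel U) := by
  classical
  obtain ⟨e, he⟩ := exists_surjective_nat X
  obtain ⟨h, hh⟩ := hT
  let fiber (A : Set (X × X)) (n : ℕ) : Set X :=
    if {y | (e n, y) ∈ A} ∈ U then {y | (e n, y) ∈ A} else univ
  have hfiber : ∀ A n, fiber A n ∈ U := fun A n => by
    dsimp only [fiber]
    split_ifs with hA
    exacts [hA, Filter.univ_mem]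
  choose P hPU hPI using fun A => hpip (fiber A) (hfiber A)
  let error (A : Set (X × X)) (n : ℕ) : {J : Set X // J ∈ I} := ⟨P A \ fiber A n, hPI A n⟩
  refine ⟨fun A => ⟨({x | {y | (x, y) ∈ A.1} ∈ U} ∩ P A.1) ∩ (h (error A.1)).1,
    Filter.inter_mem (Filter.inter_mem (mem_fubini.1 A.2) (hPU _)) (h (error A.1)).2⟩,
    fun S hS => mt ?_ hS⟩
  rintro ⟨⟨C, hC⟩, hCS⟩
  replace hCS : ∀ A ∈ S, C ⊆ ({x | {y | (x, y) ∈ A.1} ∈ U} ∩ P A.1) ∩ (h (error A.1)).1 :=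
    fun A hA => hCS _ (mem_image_of_mem _ hA)
  obtain ⟨J, hJ⟩ : RelBounded (seqRel (subRel I)) ((fun A => error A.1) '' S) := by
    refine not_not.1 fun hunb => hh _ hunb ⟨⟨C, hC⟩, ?_⟩
    rintro _ ⟨_, ⟨A, hA, rfl⟩, rfl⟩
    exact fun x hx => (hCS A hA hx).2
  choose k hk using he
  have hmem : {p : X × X | p.1 ∈ C ∧ p.2 ∈ C ∩ (J (k p.1)).1ᶜ} ∈ fubini U U := by
    rw [mem_fubini]
    filter_upwards [hC] with x hx
    filter_upwards [hC, hIU _ (J (k x)).2] with y hy hyJ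
    exact ⟨hx, hy, hyJ⟩
  refine ⟨⟨_, hmem⟩, fun A hA => ?_⟩
  rintro ⟨x, y⟩ ⟨hx, hy, hyJ⟩
  have hxA : {z | (x, z) ∈ A.1} ∈ U := (hCS A hA hx).1.1
  have hyfiber : y ∈ fiber A.1 (k x) := by
    by_contra hn
    exact hyJ (hJ _ (mem_image_of_mem _ hA) (k x) ⟨(hCS A hA hy).1.2, hn⟩)
  dsimp only [fiber] at hyfiber
  rwa [hk, if_pos hxA] at hyfiber

/-- If `U` is an ultrafilter on a countably infinite set `X`, `I ⊆ U*`
is an ideal on `X`, `U` has the `I`-pseudo-intersection property, and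
`∏_{n<ω} I ≤_T U`, then `U·U ≡_T U`. -/
theorem stmt5 {X : Type*} [Countable X] [Infinite X] (U : Ultrafilter X)
    (I : Set (Set X)) (hI : IsIdeal I) (hIU : ∀ A ∈ I, Aᶜ ∈ U)
    (hpip : HasPIP (U : Filter X) I)
    (hT : TukeyLE (seqRel (subRel I)) (filtRel (U : Filter X))) :
    TukeyEquiv (filtRel (fubini (U : Filter X) (U : Filter X)))
      (filtRel (U : Filter X)) := by
  exact ⟨fubini_self_tukeyLE U I hIU hpip hT, tukeyLE_fubini_left (U : Filter X) (U : Filter X)⟩
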